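/- Suppose |γ¹ − γ²| < min( 16λ / (27 a² T³ (γ¹ + γ²) + 48 T β λ), 32 λ² / (81 a⁴ T⁵ (γ¹ + γ²)² + 72 a² T³ β (γ¹ + γ²) λ + 32 T β λ²) ). Then the coupled Riccati system B′(t) = ((γ¹ − γ²)/2) β (a + B(t)) − C(t)E(t), C′(t) = ((γ¹ − γ²)/2)(a + B(t))² − C(t)F(t), E′(t) = ((γ¹ + γ²)/(2λ)) β (a + B(t)) − E(t)F(t), F′(t) = ((γ¹ + γ²)/(2λ))(a + B(t))² − F(t)², with terminal conditions B(T) = C(T) = E(T) = F(T) = 0, has a unique solution (B, C, E, F) of continuously differentiable functions on [0, T]. -/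

import Mathlib

open Set

/-- The coupled Riccati system from Proposition 4.4 of the paper:
`(B, C, E, F)` is a continuously differentiable solution on `[0, T]` of
`B′(t) = ((γ¹ − γ²)/2) β (a + B(t)) − C(t)E(t)`,
`C′(t) = ((γ¹ − γ²)/2)(a + B(t))² − C(t)F(t)`,
`E′(t) = ((γ¹ + γ²)/(2λ)) β (a + B(t)) − E(t)F(t)`,
`F′(t) = ((γ¹ + γ²)/(2λ))(a + B(t))² − F(t)²`,
with terminal conditions `B(T) = C(T) = E(T) = F(T) = 0`. -/
def RiccatiSystem (γ1 γ2 lam β a T : ℝ) (B C E F : ℝ → ℝ) : Prop :=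
  ContDiffOn ℝ 1 B (Icc 0 T) ∧ ContDiffOn ℝ 1 C (Icc 0 T) ∧
  ContDiffOn ℝ 1 E (Icc 0 T) ∧ ContDiffOn ℝ 1 F (Icc 0 T) ∧
  (∀ t ∈ Icc (0:ℝ) T,
      HasDerivWithinAt B ((γ1 - γ2) / 2 * β * (a + B t) - C t * E t) (Icc 0 T) t ∧
      HasDerivWithinAt C ((γ1 - γ2) / 2 * (a + B t) ^ 2 - C t * F t) (Icc 0 T) t ∧
      HasDerivWithinAt E ((γ1 + γ2) / (2 * lam) * β * (a + B t) - E t * F t) (Icc 0 T) t ∧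
      HasDerivWithinAt F ((γ1 + γ2) / (2 * lam) * (a + B t) ^ 2 - F t ^ 2) (Icc 0 T) t) ∧
  B T = 0 ∧ C T = 0 ∧ E T = 0 ∧ F T = 0

/-- The Riccati vector field. -/
def ricField (δ σ β a : ℝ) (x : ℝ × ℝ × ℝ × ℝ) : ℝ × ℝ × ℝ × ℝ :=
  (δ * β * (a + x.1) - x.2.1 * x.2.2.1,
   δ * (a + x.1) ^ 2 - x.2.1 * x.2.2.2,
   σ * β * (a + x.1) - x.2.2.1 * x.2.2.2,
   σ * (a + x.1) ^ 2 - x.2.2.2 ^ 2)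

lemma ricField_contDiff (δ σ β a : ℝ) : ContDiff ℝ 1 (ricField δ σ β a) := by
  unfold ricField
  fun_prop

/-- Clamping a real to `[lo, hi]`. -/
def cl (lo hi x : ℝ) : ℝ := max lo (min x hi)

lemma cl_le {lo hi : ℝ} (h : lo ≤ hi) (x : ℝ) : cl lo hi x ≤ hi :=
  max_le h (min_le_right _ _)

lemma le_cl (lo hi x : ℝ) : lo ≤ cl lo hi x := le_max_left _ _

lemma cl_eq {lo hi x : ℝ} (h1 : lo ≤ x) (h2 : x ≤ hi) : cl lo hi x = x := by
  unfold cl; rw [min_eq_left h2, max_eq_right h1]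

lemma cl_lip (lo hi : ℝ) : LipschitzWith 1 (cl lo hi) :=
  (LipschitzWith.id.min_const hi).const_max lo

lemma cl_nonneg {lo hi x : ℝ} (h : 0 ≤ hi) (hx : 0 ≤ x) : 0 ≤ cl lo hi x :=
  le_trans (le_min hx h) (le_max_right _ _)

lemma cl_nonpos {lo hi x : ℝ} (h : lo ≤ 0) (hx : x ≤ 0) : cl lo hi x ≤ 0 :=
  max_le h ((min_le_left _ _).trans hx)

/-- Clamping in each coordinate. -/
def clamp4 (l1 h1 l2 h2 l3 h3 l4 h4 : ℝ) (x : ℝ × ℝ × ℝ × ℝ) : ℝ × ℝ × ℝ × ℝ :=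
  (cl l1 h1 x.1, cl l2 h2 x.2.1, cl l3 h3 x.2.2.1, cl l4 h4 x.2.2.2)

lemma clamp4_lip (l1 h1 l2 h2 l3 h3 l4 h4 : ℝ) :
    LocallyLipschitz (clamp4 l1 h1 l2 h2 l3 h3 l4 h4) := by
  have f2 : LipschitzWith (1 * 1) (fun x : ℝ × ℝ × ℝ × ℝ => x.2.1) :=
    LipschitzWith.prod_fst.comp LipschitzWith.prod_snd
  have f3 : LipschitzWith (1 * (1 * 1)) (fun x : ℝ × ℝ × ℝ × ℝ => x.2.2.1) :=
    LipschitzWith.prod_fst.comp (LipschitzWith.prod_snd.comp LipschitzWith.prod_snd)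
  have f4 : LipschitzWith (1 * (1 * 1)) (fun x : ℝ × ℝ × ℝ × ℝ => x.2.2.2) :=
    LipschitzWith.prod_snd.comp (LipschitzWith.prod_snd.comp LipschitzWith.prod_snd)
  exact (((cl_lip l1 h1).comp LipschitzWith.prod_fst).prodMk
    (((cl_lip l2 h2).comp f2).prodMk
      (((cl_lip l3 h3).comp f3).prodMk ((cl_lip l4 h4).comp f4)))).locallyLipschitz

/-- Global existence for a bounded locally Lipschitz field. -/
lemma exists_of_bounded (f : ℝ × ℝ × ℝ × ℝ → ℝ × ℝ × ℝ × ℝ) (hf : LocallyLipschitz f)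
    (L : NNReal) (hL : ∀ x, ‖f x‖ ≤ L) (T : ℝ) (hT : 0 < T) :
    ∃ α : ℝ → ℝ × ℝ × ℝ × ℝ, α T = 0 ∧
      ∀ t ∈ Icc 0 T, HasDerivWithinAt α (f (α t)) (Icc 0 T) t := by
  obtain ⟨K, hK⟩ := LocallyLipschitzOn.exists_lipschitzOnWith_of_compact
    (isCompact_closedBall (0 : ℝ × ℝ × ℝ × ℝ) ((L * ⟨T, hT.le⟩ : NNReal) : ℝ))
    hf.locallyLipschitzOn
  have hp : IsPicardLindelof (fun _ : ℝ => f) (tmin := 0) (tmax := T) ⟨T, hT.le, le_rfl⟩ 0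
      (L * ⟨T, hT.le⟩) 0 L K := by
    refine IsPicardLindelof.of_time_independent (fun x _ => hL x) hK ?_
    have h : max (T - T) (T - 0) = T := by rw [sub_self, sub_zero]; exact max_eq_right hT.le
    show (L : ℝ) * max (T - T) (T - 0) ≤ (L : ℝ) * T - 0
    rw [h, sub_zero]
  exact hp.exists_eq_forall_mem_Icc_hasDerivWithinAt₀

/-- A backward barrier lemma. -/
lemma barrier (g g' : ℝ → ℝ) (T : ℝ)
    (hg : ∀ t ∈ Icc 0 T, HasDerivWithinAt g (g' t) (Icc 0 T) t) (h0 : g T ≤ 0)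
    (hb : ∀ t ∈ Icc 0 T, 0 < g t → 0 ≤ g' t) : ∀ t ∈ Icc 0 T, g t ≤ 0 := by
  intro t ht
  have hTn : 0 ≤ T := ht.1.trans ht.2
  have hmaps : MapsTo (fun s : ℝ => T - s) (Icc 0 T) (Icc 0 T) := by
    intro s hs
    exact ⟨by linarith [hs.2], by linarith [hs.1]⟩
  have hder : ∀ s ∈ Icc 0 T,
      HasDerivWithinAt (fun s => g (T - s)) (-g' (T - s)) (Icc 0 T) s := by
    intro s hs
    have h1 : HasDerivWithinAt (fun s : ℝ => T - s) (-1) (Icc 0 T) s :=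
      (hasDerivWithinAt_id s _).const_sub T
    have := (hg (T - s) (hmaps hs)).scomp s h1 hmaps
    simpa [Function.comp_def] using this
  have key : ∀ ε > 0, g t ≤ ε * (1 + T) := by
    intro ε hε
    have := image_le_of_deriv_right_lt_deriv_boundary' (a := 0) (b := T)
      (f := fun s => g (T - s)) (f' := fun s => -g' (T - s))
      (fun s hs => (hder s hs).continuousWithinAt)
      (fun s hs => (hder s ⟨hs.1, hs.2.le⟩).mono_of_mem_nhdsWithin
        (mem_nhdsGE_iff_exists_mem_Ioc_Ico_subset (u' := T) hs.2 |>.2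
          ⟨T, ⟨hs.2, le_rfl⟩, fun y hy => ⟨hs.1.trans hy.1, hy.2.le⟩⟩))
      (B := fun s => ε * (1 + s)) (B' := fun _ => ε)
      (by simp; linarith) (by fun_prop)
      (fun s _ => by
        have := ((hasDerivWithinAt_id s (Ici s)).const_add 1).const_mul ε
        simpa using this)
      (fun s hs hEq => by
        have hpos : 0 < g (T - s) := by
          have : g (T - s) = ε * (1 + s) := hEq
          rw [this]
          have := hs.1
          positivity
        have := hb (T - s) (hmaps ⟨hs.1, hs.2.le⟩) hpos
        show -g' (T - s) < ε
        linarith)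
      (hmaps ht)
    simp only [sub_sub_cancel] at this
    have h2 : ε * (1 + (T - t)) ≤ ε * (1 + T) := by
      apply mul_le_mul_of_nonneg_left _ hε.le
      linarith [ht.1]
    linarith
  by_contra hcon
  push Not at hcon
  have := key (g t / (2 * (1 + T))) (by positivity)
  have h3 : g t / (2 * (1 + T)) * (1 + T) = g t / 2 := by field_simp
  linarith

/-- Barrier with a linear-in-time bound. -/
lemma barrier_lin (g g' : ℝ → ℝ) (T k : ℝ) (hk : 0 ≤ k)
    (hg : ∀ t ∈ Icc 0 T, HasDerivWithinAt g (g' t) (Icc 0 T) t) (h0 : g T = 0)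
    (hb : ∀ t ∈ Icc 0 T, 0 < g t → -k ≤ g' t) : ∀ t ∈ Icc 0 T, g t ≤ k * T := by
  intro t ht
  have := barrier (fun t => g t - k * (T - t)) (fun t => g' t + k) T
    (fun t ht => by
      have h1 := ((hasDerivWithinAt_id t (Icc 0 T)).const_sub T).const_mul k
      have h2 : HasDerivWithinAt (fun t => g t - k * (T - t)) (g' t - k * -1) (Icc 0 T) t :=
        (hg t ht).sub h1
      have h3 : g' t - k * -1 = g' t + k := by ring
      rwa [h3] at h2)
    (by simp [h0])
    (fun t ht hpos => by
      have h2 : 0 ≤ k * (T - t) := mul_nonneg hk (by linarith [ht.2])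
      have := hb t ht (by linarith)
      linarith) t ht
  have h3 : k * (T - t) ≤ k * T := mul_le_mul_of_nonneg_left (by linarith [ht.1]) hk
  linarith

lemma exists_truncated (δ σ β a l1 h1 l2 h2 l3 h3 l4 h4 T : ℝ) (hT : 0 < T)
    (H1 : l1 ≤ h1) (H2 : l2 ≤ h2) (H3 : l3 ≤ h3) (H4 : l4 ≤ h4) :
    ∃ α : ℝ → ℝ × ℝ × ℝ × ℝ, α T = 0 ∧
      ∀ t ∈ Icc 0 T, HasDerivWithinAt α
        (ricField δ σ β a (clamp4 l1 h1 l2 h2 l3 h3 l4 h4 (α t))) (Icc 0 T) t := by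
  have hcomp : IsCompact (Icc l1 h1 ×ˢ Icc l2 h2 ×ˢ Icc l3 h3 ×ˢ Icc l4 h4) :=
    isCompact_Icc.prod (isCompact_Icc.prod (isCompact_Icc.prod isCompact_Icc))
  obtain ⟨M, hM⟩ := hcomp.exists_bound_of_continuousOn
    (ricField_contDiff δ σ β a).continuous.continuousOn
  refine exists_of_bounded (fun x => ricField δ σ β a (clamp4 l1 h1 l2 h2 l3 h3 l4 h4 x))
    ((ricField_contDiff δ σ β a).locallyLipschitz.comp (clamp4_lip _ _ _ _ _ _ _ _))
    (Real.toNNReal M) ?_ T hT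
  intro x
  refine (hM _ ?_).trans (Real.le_coe_toNNReal M)
  exact ⟨⟨le_cl _ _ _, cl_le H1 _⟩, ⟨le_cl _ _ _, cl_le H2 _⟩, ⟨le_cl _ _ _, cl_le H3 _⟩,
    ⟨le_cl _ _ _, cl_le H4 _⟩⟩

lemma components {α : ℝ → ℝ × ℝ × ℝ × ℝ} {v : ℝ × ℝ × ℝ × ℝ} {s : Set ℝ} {t : ℝ}
    (h : HasDerivWithinAt α v s t) :
    HasDerivWithinAt (fun t => (α t).1) v.1 s t ∧
    HasDerivWithinAt (fun t => (α t).2.1) v.2.1 s t ∧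
    HasDerivWithinAt (fun t => (α t).2.2.1) v.2.2.1 s t ∧
    HasDerivWithinAt (fun t => (α t).2.2.2) v.2.2.2 s t := by
  have e1 := h.hasFDerivWithinAt.fst.hasDerivWithinAt
  have e2 := h.hasFDerivWithinAt.snd.fst.hasDerivWithinAt
  have e3 := h.hasFDerivWithinAt.snd.snd.fst.hasDerivWithinAt
  have e4 := h.hasFDerivWithinAt.snd.snd.snd.hasDerivWithinAt
  refine ⟨by simpa using e1, by simpa using e2, by simpa using e3, by simpa using e4⟩

lemma contDiffOn_of_deriv {f f' : ℝ → ℝ} {T : ℝ} (hT : 0 < T)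
    (h : ∀ t ∈ Icc 0 T, HasDerivWithinAt f (f' t) (Icc 0 T) t)
    (hc : ContinuousOn f' (Icc 0 T)) : ContDiffOn ℝ 1 f (Icc 0 T) := by
  have hu := uniqueDiffOn_Icc hT
  rw [contDiffOn_one_iff_derivWithin hu]
  refine ⟨fun t ht => (h t ht).differentiableWithinAt, hc.congr ?_⟩
  intro t ht
  exact (h t ht).derivWithin (hu t ht)

lemma smallness (D S lam β a T : ℝ) (hS : 0 < S) (hlam : 0 < lam) (hβ : 0 < β) (ha : 0 < a)
    (hT : 0 < T) (hD : 0 ≤ D)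
    (h1 : D < 16 * lam / (27 * a ^ 2 * T ^ 3 * S + 48 * T * β * lam))
    (h2 : D < 32 * lam ^ 2 /
          (81 * a ^ 4 * T ^ 5 * S ^ 2 + 72 * a ^ 2 * T ^ 3 * β * S * lam
            + 32 * T * β * lam ^ 2)) :
    (D / 2 * β * (3 / 2 * a) + (D / 2 * (9 / 4 * a ^ 2) * T) *
      (S / (2 * lam) * β * (3 / 2 * a) * T)) * T ≤ a / 2 := by
  rw [lt_div_iff₀ (by positivity)] at h1 h2
  have p1 : 0 ≤ D * (27 * a ^ 2 * T ^ 3 * S) := by positivity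
  have p2 : 0 ≤ D * (81 * a ^ 4 * T ^ 5 * S ^ 2) := by positivity
  have q1 : (D * β * T) * 3 ≤ 1 := by
    have : lam * ((D * β * T) * 3) ≤ lam * 1 := by nlinarith
    exact le_of_mul_le_mul_left this hlam
  have q2 : 72 * (D * a ^ 2 * T ^ 3 * β * S) + 32 * (D * β * T) * lam ≤ 32 * lam := by
    have : lam * (72 * (D * a ^ 2 * T ^ 3 * β * S) + 32 * (D * β * T) * lam)
        ≤ lam * (32 * lam) := by nlinarith
    exact le_of_mul_le_mul_left this hlam
  have e : (D / 2 * β * (3 / 2 * a) + (D / 2 * (9 / 4 * a ^ 2) * T) *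
      (S / (2 * lam) * β * (3 / 2 * a) * T)) * T =
      a / 2 * ((24 * (D * β * T) * lam + 27 * (D * a ^ 2 * T ^ 3 * β * S)) / (16 * lam)) := by
    field_simp
    ring
  rw [e]
  have : (24 * (D * β * T) * lam + 27 * (D * a ^ 2 * T ^ 3 * β * S)) / (16 * lam) ≤ 1 := by
    rw [div_le_one (by positivity)]
    nlinarith
  have := mul_le_mul_of_nonneg_left this (by positivity : 0 ≤ a / 2)
  linarith

lemma existence (δ σ β a T : ℝ) (hσ : 0 < σ) (hβ : 0 < β) (ha : 0 < a) (hT : 0 < T)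
    (hs : (|δ| * β * (3 / 2 * a) + (|δ| * (9 / 4 * a ^ 2) * T) *
      (σ * β * (3 / 2 * a) * T)) * T ≤ a / 2) :
    ∃ α : ℝ → ℝ × ℝ × ℝ × ℝ, α T = 0 ∧
      ∀ t ∈ Icc 0 T, HasDerivWithinAt α (ricField δ σ β a (α t)) (Icc 0 T) t := by
  set k := |δ| * (9 / 4 * a ^ 2) with hk
  set l := σ * β * (3 / 2 * a) with hl
  set m := σ * (9 / 4 * a ^ 2) with hm
  have hk0 : 0 ≤ k := by positivity
  have hl0 : 0 ≤ l := by positivity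
  have hm0 : 0 ≤ m := by positivity
  have hkT : 0 ≤ k * T := by positivity
  have hlT : 0 ≤ l * T := by positivity
  have hmT : 0 ≤ m * T := by positivity
  obtain ⟨α, hα0, hα⟩ := exists_truncated δ σ β a (-(a / 2)) (a / 2) (-(k * T)) (k * T)
    (-(l * T)) (l * T) (-(m * T)) 0 T hT (by linarith) (by linarith) (by linarith) (by linarith)
  refine ⟨α, hα0, ?_⟩
  have hB := fun t ht => (components (hα t ht)).1
  have hC := fun t ht => (components (hα t ht)).2.1
  have hE := fun t ht => (components (hα t ht)).2.2.1
  have hF := fun t ht => (components (hα t ht)).2.2.2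
  simp only [ricField, clamp4] at hB hC hE hF
  -- bounds on the clamped variables
  have bu : ∀ t, a / 2 ≤ a + cl (-(a / 2)) (a / 2) (α t).1 ∧
      a + cl (-(a / 2)) (a / 2) (α t).1 ≤ 3 / 2 * a := fun t =>
    ⟨by linarith [le_cl (-(a / 2)) (a / 2) (α t).1],
     by linarith [cl_le (by linarith : -(a / 2) ≤ a / 2) (α t).1]⟩
  have bu2 : ∀ t, 0 ≤ (a + cl (-(a / 2)) (a / 2) (α t).1) ^ 2 ∧
      (a + cl (-(a / 2)) (a / 2) (α t).1) ^ 2 ≤ 9 / 4 * a ^ 2 := fun t =>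
    ⟨sq_nonneg _, by nlinarith [bu t]⟩
  have bφ : ∀ t, cl (-(m * T)) 0 (α t).2.2.2 ≤ 0 := fun t => cl_le (by linarith) _
  have bδ : ∀ x y : ℝ, 0 ≤ x → x ≤ y → |δ * x| ≤ |δ| * y := fun x y hx hxy => by
    rw [abs_mul, abs_of_nonneg hx]
    exact mul_le_mul_of_nonneg_left hxy (abs_nonneg _)
  have F1 : ∀ t ∈ Icc 0 T, (α t).2.2.2 ≤ 0 := by
    refine barrier _ _ T hF (by simp [hα0]) ?_
    intro t ht hpos
    have h0 : cl (-(m * T)) 0 (α t).2.2.2 = 0 :=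
      le_antisymm (bφ t) (cl_nonneg le_rfl hpos.le)
    rw [h0]
    have := mul_nonneg hσ.le (bu2 t).1
    simpa using this
  have F2 : ∀ t ∈ Icc 0 T, -(α t).2.2.2 ≤ m * T := by
    refine barrier_lin _ _ T m hm0 (fun t ht => (hF t ht).neg) (by simp [hα0]) ?_
    intro t ht _
    have := mul_le_mul_of_nonneg_left (bu2 t).2 hσ.le
    nlinarith [sq_nonneg (cl (-(m * T)) 0 (α t).2.2.2)]
  have C1 : ∀ t ∈ Icc 0 T, (α t).2.1 ≤ k * T := by
    refine barrier_lin _ _ T k hk0 hC (by simp [hα0]) ?_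
    intro t ht hpos
    have h1 := (abs_le.1 (bδ _ _ (bu2 t).1 (bu2 t).2)).1
    have h2 := mul_nonpos_of_nonneg_of_nonpos
      (cl_nonneg (lo := -(k * T)) hkT hpos.le) (bφ t)
    linarith
  have C2 : ∀ t ∈ Icc 0 T, -(α t).2.1 ≤ k * T := by
    refine barrier_lin _ _ T k hk0 (fun t ht => (hC t ht).neg) (by simp [hα0]) ?_
    intro t ht hpos
    have h1 := (abs_le.1 (bδ _ _ (bu2 t).1 (bu2 t).2)).2
    have h2 := mul_nonneg_of_nonpos_of_nonpos
      (cl_nonpos (lo := -(k * T)) (hi := k * T) (x := (α t).2.1) (by linarith)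
        (by simp at hpos; linarith)) (bφ t)
    linarith
  have bl : ∀ t, 0 ≤ σ * β * (a + cl (-(a / 2)) (a / 2) (α t).1) ∧
      σ * β * (a + cl (-(a / 2)) (a / 2) (α t).1) ≤ l := fun t => by
    have : 0 ≤ σ * β := by positivity
    exact ⟨mul_nonneg this (by linarith [(bu t).1]), mul_le_mul_of_nonneg_left (bu t).2 this⟩
  have E1 : ∀ t ∈ Icc 0 T, (α t).2.2.1 ≤ l * T := by
    refine barrier_lin _ _ T l hl0 hE (by simp [hα0]) ?_
    intro t ht hpos
    have h2 := mul_nonpos_of_nonneg_of_nonpos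
      (cl_nonneg (lo := -(l * T)) hlT hpos.le) (bφ t)
    linarith [(bl t).1]
  have E2 : ∀ t ∈ Icc 0 T, -(α t).2.2.1 ≤ l * T := by
    refine barrier_lin _ _ T l hl0 (fun t ht => (hE t ht).neg) (by simp [hα0]) ?_
    intro t ht hpos
    have h2 := mul_nonneg_of_nonpos_of_nonpos
      (cl_nonpos (lo := -(l * T)) (hi := l * T) (x := (α t).2.2.1) (by linarith)
        (by simp at hpos; linarith)) (bφ t)
    linarith [(bl t).2]
  set K := |δ| * β * (3 / 2 * a) + k * T * (l * T) with hK
  have hK0 : 0 ≤ K := by positivity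
  have bB : ∀ t, |δ * β * (a + cl (-(a / 2)) (a / 2) (α t).1) -
      cl (-(k * T)) (k * T) (α t).2.1 * cl (-(l * T)) (l * T) (α t).2.2.1| ≤ K := by
    intro t
    refine (abs_sub _ _).trans ?_
    have h1 : |δ * β * (a + cl (-(a / 2)) (a / 2) (α t).1)| ≤ |δ| * β * (3 / 2 * a) := by
      rw [mul_assoc, mul_assoc]
      exact bδ _ _ (mul_nonneg hβ.le (by linarith [(bu t).1]))
        (mul_le_mul_of_nonneg_left (bu t).2 hβ.le)
    have h2 : |cl (-(k * T)) (k * T) (α t).2.1| ≤ k * T :=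
      abs_le.2 ⟨le_cl _ _ _, cl_le (by linarith) _⟩
    have h3 : |cl (-(l * T)) (l * T) (α t).2.2.1| ≤ l * T :=
      abs_le.2 ⟨le_cl _ _ _, cl_le (by linarith) _⟩
    have h4 := mul_le_mul h2 h3 (abs_nonneg _) hkT
    rw [← abs_mul] at h4
    linarith
  have B1 : ∀ t ∈ Icc 0 T, (α t).1 ≤ K * T := by
    refine barrier_lin _ _ T K hK0 hB (by simp [hα0]) ?_
    intro t ht _
    exact (abs_le.1 (bB t)).1
  have B2 : ∀ t ∈ Icc 0 T, -(α t).1 ≤ K * T := by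
    refine barrier_lin _ _ T K hK0 (fun t ht => (hB t ht).neg) (by simp [hα0]) ?_
    intro t ht _
    exact neg_le_neg (abs_le.1 (bB t)).2
  intro t ht
  have hfix : clamp4 (-(a / 2)) (a / 2) (-(k * T)) (k * T)
    (-(l * T)) (l * T) (-(m * T)) 0 (α t) = α t := by
    unfold clamp4
    rw [cl_eq (by linarith [B2 t ht]) (by linarith [B1 t ht]),
      cl_eq (by linarith [C2 t ht]) (C1 t ht),
      cl_eq (by linarith [E2 t ht]) (E1 t ht),
      cl_eq (by linarith [F2 t ht]) (F1 t ht)]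
  have := hα t ht
  rwa [hfix] at this

lemma uniqueness (δ σ β a T : ℝ) (x y : ℝ → ℝ × ℝ × ℝ × ℝ)
    (hx : ∀ t ∈ Icc 0 T, HasDerivWithinAt x (ricField δ σ β a (x t)) (Icc 0 T) t)
    (hy : ∀ t ∈ Icc 0 T, HasDerivWithinAt y (ricField δ σ β a (y t)) (Icc 0 T) t)
    (hxy : x T = y T) : EqOn x y (Icc 0 T) := by
  have cx : ContinuousOn x (Icc 0 T) := fun t ht => (hx t ht).continuousWithinAt
  have cy : ContinuousOn y (Icc 0 T) := fun t ht => (hy t ht).continuousWithinAt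
  have hc : IsCompact (x '' Icc 0 T ∪ y '' Icc 0 T) :=
    (isCompact_Icc.image_of_continuousOn cx).union (isCompact_Icc.image_of_continuousOn cy)
  obtain ⟨K, hK⟩ := LocallyLipschitzOn.exists_lipschitzOnWith_of_compact hc
    (ricField_contDiff δ σ β a).locallyLipschitz.locallyLipschitzOn
  have hn : ∀ t ∈ Ioc 0 T, Icc 0 T ∈ nhdsWithin t (Iic t) := fun t ht =>
    Filter.mem_of_superset (Icc_mem_nhdsLE ht.1) (Icc_subset_Icc le_rfl ht.2)
  exact ODE_solution_unique_of_mem_Icc_left (v := fun _ => ricField δ σ β a)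
    (s := fun _ => x '' Icc 0 T ∪ y '' Icc 0 T) (K := K)
    (fun _ _ => hK) cx
    (fun t ht => (hx t ⟨ht.1.le, ht.2⟩).mono_of_mem_nhdsWithin (hn t ht))
    (fun t ht => Or.inl ⟨t, ⟨ht.1.le, ht.2⟩, rfl⟩) cy
    (fun t ht => (hy t ⟨ht.1.le, ht.2⟩).mono_of_mem_nhdsWithin (hn t ht))
    (fun t ht => Or.inr ⟨t, ⟨ht.1.le, ht.2⟩, rfl⟩) hxy

lemma RiccatiSystem.pack {γ1 γ2 lam β a T : ℝ} {B C E F : ℝ → ℝ}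
    (h : RiccatiSystem γ1 γ2 lam β a T B C E F) :
    ∀ t ∈ Icc 0 T, HasDerivWithinAt (fun t => (B t, C t, E t, F t))
      (ricField ((γ1 - γ2) / 2) ((γ1 + γ2) / (2 * lam)) β a (B t, C t, E t, F t))
      (Icc 0 T) t := by
  intro t ht
  obtain ⟨-, -, -, -, h, -⟩ := h
  obtain ⟨h1, h2, h3, h4⟩ := h t ht
  exact h1.prodMk (h2.prodMk (h3.prodMk h4))

/-- Theorem 5.2: for sufficiently similar risk aversions, the coupled Riccati system
has a unique solution on `[0, T]`. -/
theorem riccati_system_exists_unique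
    (γ1 γ2 lam β a s T : ℝ)
    (hγ1 : 0 < γ1) (hγ2 : 0 < γ2) (hlam : 0 < lam) (hβ : 0 < β) (ha : 0 < a) (hT : 0 < T)
    (hsmall : |γ1 - γ2| <
      min (16 * lam / (27 * a ^ 2 * T ^ 3 * (γ1 + γ2) + 48 * T * β * lam))
        (32 * lam ^ 2 /
          (81 * a ^ 4 * T ^ 5 * (γ1 + γ2) ^ 2 + 72 * a ^ 2 * T ^ 3 * β * (γ1 + γ2) * lam
            + 32 * T * β * lam ^ 2))) :
    (∃ B C E F : ℝ → ℝ, RiccatiSystem γ1 γ2 lam β a T B C E F) ∧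
    (∀ B C E F B' C' E' F' : ℝ → ℝ,
      RiccatiSystem γ1 γ2 lam β a T B C E F → RiccatiSystem γ1 γ2 lam β a T B' C' E' F' →
      EqOn B B' (Icc 0 T) ∧ EqOn C C' (Icc 0 T) ∧ EqOn E E' (Icc 0 T) ∧
        EqOn F F' (Icc 0 T)) := by
  have hS : 0 < γ1 + γ2 := by linarith
  constructor
  · have hs := smallness |γ1 - γ2| (γ1 + γ2) lam β a T hS hlam hβ ha hT (abs_nonneg _)
      (hsmall.trans_le (min_le_left _ _)) (hsmall.trans_le (min_le_right _ _))
    have habs : |(γ1 - γ2) / 2| = |γ1 - γ2| / 2 := by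
      rw [abs_div, abs_of_pos (by norm_num : (0 : ℝ) < 2)]
    rw [← habs] at hs
    obtain ⟨α, hα0, hα⟩ := existence ((γ1 - γ2) / 2) ((γ1 + γ2) / (2 * lam)) β a T
      (by positivity) hβ ha hT hs
    have hB := fun t ht => (components (hα t ht)).1
    have hC := fun t ht => (components (hα t ht)).2.1
    have hE := fun t ht => (components (hα t ht)).2.2.1
    have hF := fun t ht => (components (hα t ht)).2.2.2
    have hc : ContinuousOn α (Icc 0 T) := fun t ht => (hα t ht).continuousWithinAt
    have hv := (ricField_contDiff ((γ1 - γ2) / 2) ((γ1 + γ2) / (2 * lam)) β a).continuous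
      |>.comp_continuousOn hc
    refine ⟨fun t => (α t).1, fun t => (α t).2.1, fun t => (α t).2.2.1, fun t => (α t).2.2.2,
      contDiffOn_of_deriv hT hB hv.fst, contDiffOn_of_deriv hT hC hv.snd.fst,
      contDiffOn_of_deriv hT hE hv.snd.snd.fst, contDiffOn_of_deriv hT hF hv.snd.snd.snd,
      fun t ht => ⟨hB t ht, hC t ht, hE t ht, hF t ht⟩, ?_, ?_, ?_, ?_⟩ <;> simp [hα0]
  · intro B C E F B' C' E' F' h h'
    have hT0 : (B T, C T, E T, F T) = (B' T, C' T, E' T, F' T) := by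
      obtain ⟨-, -, -, -, -, h1, h2, h3, h4⟩ := h
      obtain ⟨-, -, -, -, -, h1', h2', h3', h4'⟩ := h'
      rw [h1, h2, h3, h4, h1', h2', h3', h4']
    have key := uniqueness _ _ _ _ _ _ _ h.pack h'.pack hT0
    refine ⟨fun t ht => ?_, fun t ht => ?_, fun t ht => ?_, fun t ht => ?_⟩ <;>
    · have := key ht
      simp only [Prod.mk.injEq] at this
      tauto
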